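/- Let X be standard normal, a ≥ 0, E_a := {−a < X < 0} ∪ {X > a} and 𝓖_a := σ(E_a). Then ℙ(E_a) = 1/2, E[X·1_{E_a}] = I(a)/2, and ℙ-almost surely E[X|𝓖_a] = I(a)·1_{E_a} − I(a)·1_{E_a^c}; in particular |E[X|𝓖_a]| = |I(a)| almost surely. -/

import Mathlib

open MeasureTheory ProbabilityTheory

/-- `I(a) = R₀ − 2·E[|X|·1_{|X| ≤ a}]` with `R₀ = √(2/π)`. -/
noncomputable def Ifun {Ω : Type*} {m0 : MeasurableSpace Ω} (P : Measure Ω) (X : Ω → ℝ)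
    (a : ℝ) : ℝ :=
  Real.sqrt (2 / Real.pi) - 2 * ∫ ω in {ω | |X ω| ≤ a}, |X ω| ∂P

/-- `E_a = {−a < X < 0} ∪ {X > a}`. -/
def Eset {Ω : Type*} (X : Ω → ℝ) (a : ℝ) : Set Ω :=
  {ω | -a < X ω ∧ X ω < 0} ∪ {ω | a < X ω}

/-- The first absolute moment of the standard Gaussian measure. -/
lemma integral_abs_gaussianReal_zero_one :
    ∫ x, |x| ∂(gaussianReal 0 1) = Real.sqrt (2 / Real.pi) := by
  have hpdf (x : ℝ) : gaussianPDFReal 0 1 x • |x| =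
      (Real.sqrt (2 * Real.pi))⁻¹ * (|x| ^ (1 : ℝ) * Real.exp (-(1 / 2) * |x| ^ (2 : ℝ))) := by
    simp only [gaussianPDFReal, smul_eq_mul, NNReal.coe_one, mul_one, sub_zero, Real.rpow_one,
      Real.rpow_two, sq_abs]
    rw [show -x ^ 2 / 2 = -(1 / 2) * x ^ 2 by ring]
    ring
  have hGamma : ((1 : ℝ) / 2) ^ (-(1 + 1) / 2 : ℝ) * (1 / 2) * Real.Gamma ((1 + 1) / 2) = 1 := by
    norm_num [Real.rpow_neg_one]
  rw [integral_gaussianReal_eq_integral_smul one_ne_zero, integral_congr_ae (.of_forall hpdf),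
    integral_const_mul,
    integral_comp_abs (f := fun x ↦ x ^ (1 : ℝ) * Real.exp (-(1 / 2) * x ^ (2 : ℝ))),
    integral_rpow_mul_exp_neg_mul_rpow two_pos (by norm_num) (by norm_num), hGamma]
  rw [Real.sqrt_mul zero_le_two, Real.sqrt_div zero_le_two]
  have h2 : Real.sqrt 2 ≠ 0 := by positivity
  have hpi : Real.sqrt Real.pi ≠ 0 := by positivity
  field_simp
  rw [Real.sq_sqrt zero_le_two]

lemma measurableSet_Eset {Ω : Type*} {m0 : MeasurableSpace Ω} {X : Ω → ℝ} (hX : Measurable X)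
    (a : ℝ) : MeasurableSet (Eset X a) :=
  ((measurableSet_lt measurable_const hX).inter (measurableSet_lt hX measurable_const)).union
    (measurableSet_lt measurable_const hX)

/-- A symmetric atomless law gives `E_a` and its reflection the same mass, and they partition the
line up to three points. -/
lemma measure_Eset_id_of_map_neg_eq {μ : Measure ℝ} [IsProbabilityMeasure μ] [NullSingletonClass μ]
    (hneg : μ.map (fun x ↦ -x) = μ) {a : ℝ} (ha : 0 ≤ a) : μ (Eset id a) = 1 / 2 := by
  have hS := measurableSet_Eset measurable_id a
  have hrefl : μ ((fun x : ℝ ↦ -x) ⁻¹' Eset id a) = μ (Eset id a) := by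
    rw [← Measure.map_apply measurable_neg hS, hneg]
  have hcompl : ((fun x : ℝ ↦ -x) ⁻¹' Eset id a) =ᵐ[μ] (Eset id a)ᶜ := by
    filter_upwards [Measure.ae_ne μ 0, Measure.ae_ne μ a, Measure.ae_ne μ (-a)]
      with x h0 h1 h2
    refine propext ?_
    change ((-a < -x ∧ -x < 0) ∨ a < -x) ↔ ¬((-a < x ∧ x < 0) ∨ a < x)
    grind
  have hcompl_measure : μ ((fun x : ℝ ↦ -x) ⁻¹' Eset id a) = μ (Eset id a)ᶜ :=
    measure_congr hcompl
  have hadd := measure_add_measure_compl (μ := μ) hS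
  rw [← hcompl_measure, hrefl, measure_univ, ← two_mul] at hadd
  rw [ENNReal.eq_div_iff (by simp) (by simp), hadd]

/-- The first moment over `E_a` of a symmetric atomless law. -/
lemma setIntegral_Eset_id_of_map_neg_eq {μ : Measure ℝ} [NullSingletonClass μ]
    (hneg : μ.map (fun x ↦ -x) = μ) (hint : Integrable id μ) {a : ℝ} (ha : 0 ≤ a) :
    ∫ x in Eset id a, x ∂μ = (∫ x, |x| ∂μ - 2 * ∫ x in {x | |x| ≤ a}, |x| ∂μ) / 2 := by
  have hS := measurableSet_Eset measurable_id a
  have hT : MeasurableSet {x : ℝ | |x| ≤ a} := measurableSet_le (by fun_prop) measurable_const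
  have habs : Integrable (fun x : ℝ ↦ |x|) μ := hint.abs
  have hind : Integrable ((Eset id a).indicator id) μ := hint.indicator hS
  have hrefl : ∫ x, (Eset id a).indicator id (-x) ∂μ = ∫ x, (Eset id a).indicator id x ∂μ := by
    conv_rhs => rw [← hneg]
    rw [integral_map measurable_neg.aemeasurable]
    rw [hneg]; exact hind.aestronglyMeasurable
  have hind_neg : Integrable (fun x ↦ (Eset id a).indicator id (-x)) μ := by
    refine Integrable.comp_measurable (g := (Eset id a).indicator id) ?_ measurable_neg
    rw [hneg]; exact hind
  have hsum : ∫ x, ((Eset id a).indicator id x + (Eset id a).indicator id (-x)) ∂μ =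
      ∫ x, (|x| - 2 * {x : ℝ | |x| ≤ a}.indicator (fun x ↦ |x|) x) ∂μ := by
    refine integral_congr_ae ?_
    filter_upwards [Measure.ae_ne μ a, Measure.ae_ne μ (-a)] with x h1 h2
    simp only [Set.indicator_apply, Eset, Set.mem_union, Set.mem_ofPred_eq, id]
    grind
  rw [integral_add hind hind_neg, hrefl,
    integral_sub habs ((habs.indicator hT).const_mul 2),
    integral_const_mul, integral_indicator hS, integral_indicator hT] at hsum
  simp only [id] at hsum
  linarith

/-- Conditional expectation given the σ-algebra generated by one event. -/
lemma condExp_generateFrom_singleton_ae_eq {Ω : Type*} {m0 : MeasurableSpace Ω} {P : Measure Ω}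
    [IsProbabilityMeasure P] {f : Ω → ℝ} (hf : Integrable f P) {s : Set Ω} (hs : MeasurableSet s) :
    P[f|MeasurableSpace.generateFrom {s}] =ᵐ[P] fun ω ↦
      (∫ x, f x ∂P[|s]) * s.indicator (fun _ ↦ (1 : ℝ)) ω +
        (∫ x, f x ∂P[|sᶜ]) * sᶜ.indicator (fun _ ↦ (1 : ℝ)) ω := by
  have hgen : MeasurableSpace.generateFrom {sᶜ} = MeasurableSpace.generateFrom {s} := by
    ext t
    simp only [measurableSet_generateFrom_singleton_iff, compl_compl]
    tauto
  have h1 := (ae_restrict_iff' hs).1 (condExp_generateFrom_singleton hs hf)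
  have h2 := (ae_restrict_iff' hs.compl).1 (condExp_generateFrom_singleton hs.compl hf)
  rw [hgen] at h2
  filter_upwards [h1, h2] with ω h1 h2
  by_cases h : ω ∈ s
  · rw [h1 h]; simp [h]
  · rw [h2 h]; simp [h]

/-- For a standard normal `X`, `a ≥ 0`, `E_a = {−a < X < 0} ∪ {X > a}` and `𝓖_a = σ(E_a)`:
`ℙ(E_a) = 1/2`, `E[X·1_{E_a}] = I(a)/2`, almost surely
`E[X|𝓖_a] = I(a)·1_{E_a} − I(a)·1_{E_aᶜ}`, and in particular `|E[X|𝓖_a]| = |I(a)|` a.s. -/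
theorem condexp_camouflage_sigmaAlgebra {Ω : Type*} {m0 : MeasurableSpace Ω}
    (P : Measure Ω) [IsProbabilityMeasure P]
    (X : Ω → ℝ) (hX : Measurable X)
    (hlaw : P.map X = gaussianReal 0 1)
    (a : ℝ) (ha : 0 ≤ a) :
    P (Eset X a) = 1 / 2 ∧
    (∫ ω in Eset X a, X ω ∂P) = Ifun P X a / 2 ∧
    (P[X|MeasurableSpace.generateFrom {Eset X a}] =ᵐ[P] fun ω =>
        Ifun P X a * Set.indicator (Eset X a) (fun _ => (1 : ℝ)) ω -
          Ifun P X a * Set.indicator (Eset X a)ᶜ (fun _ => (1 : ℝ)) ω) ∧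
    (∀ᵐ ω ∂P, |(P[X|MeasurableSpace.generateFrom {Eset X a}]) ω| = |Ifun P X a|) := by
  have : NullSingletonClass (gaussianReal 0 1) := nullSingletonClass_gaussianReal one_ne_zero
  have hneg : (gaussianReal 0 1).map (fun x ↦ -x) = gaussianReal 0 1 := by
    rw [gaussianReal_map_neg, neg_zero]
  have hint : Integrable id (gaussianReal 0 1) :=
    memLp_one_iff_integrable.1 (memLp_id_gaussianReal 1)
  have hXint : Integrable X P := by
    rw [← hlaw] at hint
    exact hint.comp_measurable hX
  have hE := measurableSet_Eset hX a
  have hS := measurableSet_Eset measurable_id a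
  have hprob : P (Eset X a) = 1 / 2 := by
    rw [← measure_Eset_id_of_map_neg_eq hneg ha, ← hlaw, Measure.map_apply hX hS]
    rfl
  have hmoment : ∫ ω in Eset X a, X ω ∂P = Ifun P X a / 2 := by
    have hleft : ∫ x in Eset id a, x ∂(gaussianReal 0 1) = ∫ ω in Eset X a, X ω ∂P := by
      rw [← hlaw, setIntegral_map hS (by fun_prop) hX.aemeasurable]
      rfl
    have hright : ∫ x in {x | |x| ≤ a}, |x| ∂(gaussianReal 0 1) =
        ∫ ω in {ω | |X ω| ≤ a}, |X ω| ∂P := by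
      rw [← hlaw, setIntegral_map (measurableSet_le (by fun_prop) measurable_const)
        (by fun_prop) hX.aemeasurable]
      rfl
    rw [← hleft, setIntegral_Eset_id_of_map_neg_eq hneg hint ha, hright,
      integral_abs_gaussianReal_zero_one, Ifun]
  have hmean : ∫ ω, X ω ∂P = 0 := by
    have h := integral_map (μ := P) hX.aemeasurable (f := id) aestronglyMeasurable_id
    rw [hlaw] at h
    exact h.symm.trans integral_id_gaussianReal
  have hmoment_compl : ∫ ω in (Eset X a)ᶜ, X ω ∂P = -(Ifun P X a / 2) := by
    have h := integral_add_compl hE hXint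
    linarith
  have hprob_compl : P (Eset X a)ᶜ = 1 / 2 := by
    rw [prob_compl_eq_one_sub hE, hprob, one_div, ENNReal.one_sub_inv_two]
  have hcond : P[X|MeasurableSpace.generateFrom {Eset X a}] =ᵐ[P] fun ω =>
      Ifun P X a * Set.indicator (Eset X a) (fun _ => (1 : ℝ)) ω -
        Ifun P X a * Set.indicator (Eset X a)ᶜ (fun _ => (1 : ℝ)) ω := by
    filter_upwards [condExp_generateFrom_singleton_ae_eq hXint hE] with ω hω
    rw [hω, ProbabilityTheory.cond, ProbabilityTheory.cond, integral_smul_measure,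
      integral_smul_measure, hmoment, hmoment_compl,
      hprob, hprob_compl]
    simp only [one_div, inv_inv, ENNReal.toReal_ofNat, smul_eq_mul]
    ring
  refine ⟨hprob, hmoment, hcond, ?_⟩
  filter_upwards [hcond] with ω hω
  rw [hω]
  by_cases h : ω ∈ Eset X a <;> simp [h]
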